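/- arXiv:2107.14469 — 3 statements merged into one kernel-verified Lean document; each statement's English description precedes it below -/
import Mathlib

section
/- Let f : ℝⁿ×ℝᵐ → ℝ and g : ℝⁿ×ℝᵐ → ℝᵖ be continuous. Let ȳ ∈ S(x̄) and let (xᵢ) be a sequence in ℝⁿ with xᵢ → x̄. Suppose there exist points ȳᵢ ∈ Y(xᵢ) with ȳᵢ → ȳ. Then for every sequence (yᵢ) with yᵢ ∈ S(xᵢ) for all i and yᵢ → y₀, one has y₀ ∈ S(x̄). -/
open Filter Topology

noncomputable section

/-- The lower-level feasible set `Y(x) = {y : g(x,y) ≤ 0}`. -/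
def Yset {n m p : ℕ}
    (g : EuclideanSpace ℝ (Fin n) × EuclideanSpace ℝ (Fin m) → Fin p → ℝ)
    (x : EuclideanSpace ℝ (Fin n)) : Set (EuclideanSpace ℝ (Fin m)) :=
  {y | ∀ j, g (x, y) j ≤ 0}

/-- The lower-level solution set `S(x)`. -/
def Sset {n m p : ℕ}
    (f : EuclideanSpace ℝ (Fin n) × EuclideanSpace ℝ (Fin m) → ℝ)
    (g : EuclideanSpace ℝ (Fin n) × EuclideanSpace ℝ (Fin m) → Fin p → ℝ)
    (x : EuclideanSpace ℝ (Fin n)) : Set (EuclideanSpace ℝ (Fin m)) :=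
  {y | y ∈ Yset g x ∧ ∀ y' ∈ Yset g x, f (x, y) ≤ f (x, y')}

theorem statement0 {n m p : ℕ}
    (f : EuclideanSpace ℝ (Fin n) × EuclideanSpace ℝ (Fin m) → ℝ)
    (g : EuclideanSpace ℝ (Fin n) × EuclideanSpace ℝ (Fin m) → Fin p → ℝ)
    (hf : Continuous f) (hg : Continuous g)
    (xbar : EuclideanSpace ℝ (Fin n)) (ybar : EuclideanSpace ℝ (Fin m))
    (hybar : ybar ∈ Sset f g xbar)
    (xs : ℕ → EuclideanSpace ℝ (Fin n)) (hxs : Tendsto xs atTop (𝓝 xbar))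
    (ybars : ℕ → EuclideanSpace ℝ (Fin m))
    (hybarsY : ∀ i, ybars i ∈ Yset g (xs i))
    (hybars : Tendsto ybars atTop (𝓝 ybar))
    (ys : ℕ → EuclideanSpace ℝ (Fin m))
    (hys : ∀ i, ys i ∈ Sset f g (xs i))
    (y₀ : EuclideanSpace ℝ (Fin m)) (hy₀ : Tendsto ys atTop (𝓝 y₀)) :
    y₀ ∈ Sset f g xbar := by
  have h1 : Tendsto (fun i => (xs i, ys i)) atTop (𝓝 (xbar, y₀)) := hxs.prodMk_nhds hy₀
  have h2 : Tendsto (fun i => (xs i, ybars i)) atTop (𝓝 (xbar, ybar)) := hxs.prodMk_nhds hybars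
  refine ⟨fun j => ?_, fun y' hy' => ?_⟩
  · have hgj : Continuous (fun z => g z j) := (continuous_apply j).comp hg
    exact le_of_tendsto' ((hgj.tendsto _).comp h1) (fun i => (hys i).1 j)
  · have h3 : f (xbar, y₀) ≤ f (xbar, ybar) :=
      le_of_tendsto_of_tendsto' ((hf.tendsto _).comp h1) ((hf.tendsto _).comp h2)
        (fun i => (hys i).2 _ (hybarsY i))
    exact h3.trans (hybar.2 y' hy')
end
end

section
/- Let n = 1 and let f : ℝ×ℝᵐ → ℝ, g : ℝ×ℝᵐ → ℝᵖ be three times continuously differentiable. Let ȳ ∈ Y(x̄) be a nondegenerate critical point of the lower-level problem L(x̄) (conditions ND1–ND3). Then there exist open neighborhoods U(x̄) ⊆ ℝ of x̄ and U(ȳ) ⊆ ℝᵐ of ȳ and a twice continuously differentiable map y : U(x̄) → U(ȳ) with y(x̄) = ȳ such that for all (x,y) ∈ U(x̄)×U(ȳ): y is a generalized critical point of L(x) if and only if y = y(x). In other words, Σ_gc ∩ (U(x̄)×U(ȳ)) = {(x, y(x)) : x ∈ U(x̄)}. -/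
open scoped RealInnerProductSpace
open Topology

noncomputable section

/-- The partial gradient `∇_y f (x,y)` (upper-level variable one-dimensional). -/
def gradY {m : ℕ} (f : ℝ × EuclideanSpace ℝ (Fin m) → ℝ)
    (x : ℝ) (y : EuclideanSpace ℝ (Fin m)) : EuclideanSpace ℝ (Fin m) :=
  gradient (fun y' => f (x, y')) y

/-- The partial gradient `∇_y g_j (x,y)`. -/
def gradYg {m p : ℕ} (g : ℝ × EuclideanSpace ℝ (Fin m) → Fin p → ℝ)
    (x : ℝ) (y : EuclideanSpace ℝ (Fin m)) (j : Fin p) : EuclideanSpace ℝ (Fin m) :=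
  gradient (fun y' => g (x, y') j) y

/-- The lower-level Lagrangian `f + ūᵀ g`. -/
def Lag {m p : ℕ} (f : ℝ × EuclideanSpace ℝ (Fin m) → ℝ)
    (g : ℝ × EuclideanSpace ℝ (Fin m) → Fin p → ℝ) (u : Fin p → ℝ) :
    ℝ × EuclideanSpace ℝ (Fin m) → ℝ :=
  fun z => f z + ∑ j, u j * g z j

/-- The Hessian block `∇²_{yy}(f + ūᵀg)(x̄,ȳ)` as a continuous linear map. -/
def LagYY {m p : ℕ} (f : ℝ × EuclideanSpace ℝ (Fin m) → ℝ)
    (g : ℝ × EuclideanSpace ℝ (Fin m) → Fin p → ℝ) (u : Fin p → ℝ)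
    (x : ℝ) (y : EuclideanSpace ℝ (Fin m)) :
    EuclideanSpace ℝ (Fin m) →L[ℝ] EuclideanSpace ℝ (Fin m) :=
  fderiv ℝ (fun y' => gradY (Lag f g u) x y') y

/-- `y` is a generalized critical (g.c.) point of `L(x)`. -/
def gcPoint {m p : ℕ} (f : ℝ × EuclideanSpace ℝ (Fin m) → ℝ)
    (g : ℝ × EuclideanSpace ℝ (Fin m) → Fin p → ℝ)
    (x : ℝ) (y : EuclideanSpace ℝ (Fin m)) : Prop :=
  (∀ j, g (x, y) j ≤ 0) ∧
    ∃ (u₀ : ℝ) (u : Fin p → ℝ), (u₀, u) ≠ 0 ∧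
      (∀ j, g (x, y) j ≠ 0 → u j = 0) ∧
      u₀ • gradY f x y + ∑ j, u j • gradYg g x y j = 0

/-- `Σ_gc`, the set of pairs `(x,y)` such that `y` is a g.c. point of `L(x)`. -/
def SigmaGC {m p : ℕ} (f : ℝ × EuclideanSpace ℝ (Fin m) → ℝ)
    (g : ℝ × EuclideanSpace ℝ (Fin m) → Fin p → ℝ) :
    Set (ℝ × EuclideanSpace ℝ (Fin m)) :=
  {z | gcPoint f g z.1 z.2}

abbrev EE (m : ℕ) := EuclideanSpace ℝ (Fin m)

lemma aux_cd {m : ℕ} {h : ℝ × EE m → ℝ} (hh : ContDiff ℝ 3 h) :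
    ContDiff ℝ 2 (fun z : ℝ × EE m => gradY h z.1 z.2) := by
  unfold gradY gradient
  apply (InnerProductSpace.toDual ℝ (EE m)).symm.contDiff.comp
  refine ContDiff.fderiv (m := 3) (n := 2) (f := fun (z : ℝ × EE m) (y' : EE m) => h (z.1, y')) ?_
    contDiff_snd (by norm_num)
  exact hh.comp (by fun_prop)

lemma aux_inner {m : ℕ} {h : ℝ × EE m → ℝ} (x : ℝ) (y w : EE m) :
    ⟪gradY h x y, w⟫ = fderiv ℝ (fun y' => h (x, y')) y w := by
  unfold gradY gradient
  exact InnerProductSpace.toDual_symm_apply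

lemma aux_lag {m p : ℕ} (f : ℝ × EE m → ℝ) (g : ℝ × EE m → Fin p → ℝ)
    (hf : ContDiff ℝ 3 f) (hg : ContDiff ℝ 3 g) (u : Fin p → ℝ) (x : ℝ) (y : EE m) :
    gradY (Lag f g u) x y = gradY f x y + ∑ j, u j • gradYg g x y j := by
  have hfd : DifferentiableAt ℝ (fun y' => f (x, y')) y :=
    ((hf.comp (by fun_prop : ContDiff ℝ 3 (fun y' : EE m => (x, y')))).differentiable
      (by norm_num)) y
  have hgd : ∀ j, DifferentiableAt ℝ (fun y' => g (x, y') j) y := fun j =>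
    (((contDiff_pi.1 hg j).comp
      (by fun_prop : ContDiff ℝ 3 (fun y' : EE m => (x, y')))).differentiable (by norm_num)) y
  refine ext_inner_right ℝ fun w => ?_
  rw [aux_inner, inner_add_left, sum_inner, aux_inner]
  have : HasFDerivAt (fun y' => Lag f g u (x, y'))
      (fderiv ℝ (fun y' => f (x, y')) y + ∑ j, u j • fderiv ℝ (fun y' => g (x, y') j) y) y := by
    unfold Lag
    exact hfd.hasFDerivAt.add (HasFDerivAt.fun_sum fun j _ => (hgd j).hasFDerivAt.const_mul (u j))
  rw [this.fderiv]
  simp only [add_apply, ContinuousLinearMap.sum_apply, smul_apply, inner_smul_left]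
  congr 1
  refine Finset.sum_congr rfl fun j _ => ?_
  have := aux_inner (h := fun z => g z j) x y w
  unfold gradYg
  unfold gradY at this
  rw [this]; simp

/-- locally uniform lower bound -/
lemma aux_lower {X V W : Type*} [TopologicalSpace X]
    [NormedAddCommGroup V] [NormedSpace ℝ V] [FiniteDimensional ℝ V]
    [NormedAddCommGroup W] [NormedSpace ℝ W] (T : X → V →L[ℝ] W) (hT : Continuous T) (z : X)
    (hinj : Function.Injective (T z)) :
    ∃ c > 0, ∀ᶠ z' in 𝓝 z, ∀ u, c * ‖u‖ ≤ ‖T z' u‖ := by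
  obtain ⟨K, hK, hA⟩ := (T z : V →ₗ[ℝ] W).exists_antilipschitzWith
    (LinearMap.ker_eq_bot.2 hinj)
  have hK' : (0 : ℝ) < K := hK
  have hb : ∀ u, ‖u‖ ≤ K * ‖T z u‖ := fun u => by
    have := hA.le_mul_dist u 0
    simpa using this
  refine ⟨(K : ℝ)⁻¹ / 2, by positivity, ?_⟩
  have h2 : ∀ᶠ z' in 𝓝 z, ‖T z' - T z‖ < (K : ℝ)⁻¹ / 2 := by
    have : Filter.Tendsto (fun z' => ‖T z' - T z‖) (𝓝 z) (𝓝 0) := by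
      have : Continuous (fun z' => ‖T z' - T z‖) := by fun_prop
      simpa using this.tendsto z
    exact this.eventually_lt_const (by positivity)
  filter_upwards [h2] with z' hz' u
  have h3 : ‖(T z' - T z) u‖ ≤ (K : ℝ)⁻¹ / 2 * ‖u‖ :=
    (ContinuousLinearMap.le_opNorm _ _).trans (by gcongr)
  have h4 : (K : ℝ)⁻¹ * ‖u‖ ≤ ‖T z u‖ := by
    rw [inv_mul_le_iff₀ hK']; exact hb u
  have h5 : ‖T z u‖ ≤ ‖T z' u‖ + ‖(T z' - T z) u‖ := by
    have : T z u = T z' u - (T z' - T z) u := by simp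
    rw [this]; exact norm_sub_le _ _
  linarith

lemma aux_inv {V : Type*} [NormedAddCommGroup V] [NormedSpace ℝ V] [FiniteDimensional ℝ V]
    (A : V →L[ℝ] V) (h : ∀ v, A v = 0 → v = 0) : A.IsInvertible := by
  have hinj : Function.Injective (A : V →ₗ[ℝ] V) := by
    rw [← LinearMap.ker_eq_bot, LinearMap.ker_eq_bot']; exact h
  refine ⟨(LinearEquiv.ofInjectiveEndo (A : V →ₗ[ℝ] V) hinj).toContinuousLinearEquiv, ?_⟩
  ext v; simp

/-- The KKT map. -/
def KKT {m p : ℕ} (f : ℝ × EE m → ℝ) (g : ℝ × EE m → Fin p → ℝ) (J : Set (Fin p))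
    (z : ℝ × (EE m × (Fin p → ℝ))) : EE m × (Fin p → ℝ) :=
  open Classical in
  (gradY f z.1 z.2.1 + ∑ j, z.2.2 j • gradYg g z.1 z.2.1 j,
    fun j => if j ∈ J then g (z.1, z.2.1) j else z.2.2 j)

lemma KKT_cd {m p : ℕ} (f : ℝ × EE m → ℝ) (g : ℝ × EE m → Fin p → ℝ)
    (hf : ContDiff ℝ 3 f) (hg : ContDiff ℝ 3 g) (J : Set (Fin p)) :
    ContDiff ℝ 2 (KKT f g J) := by
  have h0 : ContDiff ℝ 3 (fun z : ℝ × (EE m × (Fin p → ℝ)) => (z.1, z.2.1)) := by fun_prop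
  have h1 := (aux_cd hf).comp (h0.of_le (by norm_num))
  have h2 : ∀ j, ContDiff ℝ 2 (fun z : ℝ × (EE m × (Fin p → ℝ)) => gradYg g z.1 z.2.1 j) :=
    fun j => (aux_cd (contDiff_pi.1 hg j)).comp (h0.of_le (by norm_num))
  have h3 : ∀ j, ContDiff ℝ 2 (fun z : ℝ × (EE m × (Fin p → ℝ)) => g (z.1, z.2.1) j) :=
    fun j => ((contDiff_pi.1 hg j).comp h0).of_le (by norm_num)
  unfold KKT
  refine ContDiff.prodMk (h1.add (ContDiff.sum fun j _ => ContDiff.smul (f := fun z : ℝ × (EE m × (Fin p → ℝ)) => z.2.2 j) (by fun_prop) (h2 j))) ?_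
  refine contDiff_pi.2 fun j => ?_
  by_cases hj : j ∈ J
  · simpa [hj] using h3 j
  · simp only [hj, if_false]; fun_prop

lemma licq_zero {m p : ℕ} {J : Set (Fin p)} {v : Fin p → EE m}
    (h : LinearIndependent ℝ (fun j : {j // j ∈ J} => v j.1)) (u : Fin p → ℝ)
    (hu : ∀ j, j ∉ J → u j = 0) (hs : ∑ j, u j • v j = 0) : u = 0 := by
  classical
  have : ∑ j : {j // j ∈ J}, u j.1 • v j.1 = 0 := by
    rw [← hs, ← Finset.sum_subtype (Finset.univ.filter (· ∈ J)) (by simp) (fun j => u j • v j)]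
    refine Finset.sum_subset (Finset.subset_univ _) fun j _ hj => ?_
    rw [hu j (by simpa using hj), zero_smul]
  have h2 := Fintype.linearIndependent_iff.1 h (fun j => u j.1) this
  funext j
  by_cases hj : j ∈ J
  · exact h2 ⟨j, hj⟩
  · exact hu j hj

lemma KKT_inv {m p : ℕ}
    (f : ℝ × EE m → ℝ) (g : ℝ × EE m → Fin p → ℝ)
    (hf : ContDiff ℝ 3 f) (hg : ContDiff ℝ 3 g)
    (xbar : ℝ) (ybar : EE m) (ubar : Fin p → ℝ) (J : Set (Fin p))
    (hLICQ : LinearIndependent ℝ (fun j : {j : Fin p // j ∈ J} => gradYg g xbar ybar j.1))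
    (hSOC : ∀ w : EE m,
      (∀ j, j ∈ J → ⟪gradYg g xbar ybar j, w⟫ = 0) →
      (∀ v : EE m,
        (∀ j, j ∈ J → ⟪gradYg g xbar ybar j, v⟫ = 0) →
        ⟪LagYY f g ubar xbar ybar w, v⟫ = 0) →
      w = 0) :
    (fderiv ℝ (KKT f g J) (xbar, (ybar, ubar)) ∘L .inr ℝ ℝ (EE m × (Fin p → ℝ))).IsInvertible := by
  set A := fderiv ℝ (KKT f g J) (xbar, (ybar, ubar)) ∘L .inr ℝ ℝ (EE m × (Fin p → ℝ)) with hA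
  have hd : HasFDerivAt (KKT f g J) (fderiv ℝ (KKT f g J) (xbar, (ybar, ubar)))
      (xbar, (ybar, ubar)) :=
    ((KKT_cd f g hf hg J).differentiable (by norm_num) _).hasFDerivAt
  have hdA : HasFDerivAt (fun q => KKT f g J (xbar, q)) A (ybar, ubar) :=
    hd.comp (ybar, ubar) (hasFDerivAt_prodMk_right xbar (ybar, ubar))
  have hdy : HasFDerivAt (fun y => KKT f g J (xbar, (y, ubar)))
      (A ∘L .inl ℝ (EE m) (Fin p → ℝ)) ybar :=
    HasFDerivAt.comp (g := fun q => KKT f g J (xbar, q)) (f := fun y => (y, ubar)) ybar hdA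
      (hasFDerivAt_prodMk_left ybar ubar)
  have hdu : HasFDerivAt (fun u => KKT f g J (xbar, (ybar, u)))
      (A ∘L .inr ℝ (EE m) (Fin p → ℝ)) ubar :=
    HasFDerivAt.comp (g := fun q => KKT f g J (xbar, q)) (f := fun u => (ybar, u)) ubar hdA
      (hasFDerivAt_prodMk_right ybar ubar)
  -- components
  have y1 : ∀ w, (A (w, 0)).1 = LagYY f g ubar xbar ybar w := by
    intro w
    have h := hdy.fst.fderiv
    have h' : (fun y => (KKT f g J (xbar, (y, ubar))).1) =
        fun y' => gradY (Lag f g ubar) xbar y' := by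
      funext y; rw [aux_lag f g hf hg]; rfl
    unfold LagYY
    rw [← h', h]; rfl
  have y2 : ∀ w j, j ∈ J → (A (w, 0)).2 j = ⟪gradYg g xbar ybar j, w⟫ := by
    intro w j hj
    have h := (hasFDerivAt_pi'.1 hdy.snd j).fderiv
    have h' : (fun y => (KKT f g J (xbar, (y, ubar))).2 j) = fun y => g (xbar, y) j := by
      funext y; simp [KKT, hj]
    have h3 := aux_inner (h := fun z => g z j) xbar ybar w
    unfold gradYg
    unfold gradY at h3
    rw [h3, ← h', h]; rfl
  have y3 : ∀ w j, j ∉ J → (A (w, 0)).2 j = 0 := by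
    intro w j hj
    have h := (hasFDerivAt_pi'.1 hdy.snd j)
    have h' : (fun y => (KKT f g J (xbar, (y, ubar))).2 j) = fun y => ubar j := by
      funext y; simp [KKT, hj]
    rw [h'] at h
    have := h.unique (hasFDerivAt_const _ _)
    exact congrArg (fun L => L w) this
  have u1 : ∀ μ, (A (0, μ)).1 = ∑ j, μ j • gradYg g xbar ybar j := by
    intro μ
    have h := hdu.fst
    have h2 : HasFDerivAt (fun u => (KKT f g J (xbar, (ybar, u))).1)
        (∑ j, (ContinuousLinearMap.proj (R := ℝ) (φ := fun _ : Fin p => ℝ) j).smulRight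
          (gradYg g xbar ybar j)) ubar := by
      have h3 : HasFDerivAt (fun u : Fin p → ℝ => ∑ j, u j • gradYg g xbar ybar j)
          (∑ j, (ContinuousLinearMap.proj (R := ℝ) (φ := fun _ : Fin p => ℝ) j).smulRight
            (gradYg g xbar ybar j)) ubar := by
        refine HasFDerivAt.fun_sum fun j _ => ?_
        exact (hasFDerivAt_apply (𝕜 := ℝ) j ubar).smul_const _
      exact h3.const_add (gradY f xbar ybar)
    have := congrArg (fun L => L μ) (h.unique h2)
    simpa using this
  have u2 : ∀ μ j, j ∈ J → (A (0, μ)).2 j = 0 := by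
    intro w j hj
    have h := (hasFDerivAt_pi'.1 hdu.snd j)
    have h' : (fun u => (KKT f g J (xbar, (ybar, u))).2 j) = fun u => g (xbar, ybar) j := by
      funext y; simp [KKT, hj]
    rw [h'] at h
    have := h.unique (hasFDerivAt_const _ _)
    exact congrArg (fun L => L w) this
  have u3 : ∀ μ j, j ∉ J → (A (0, μ)).2 j = μ j := by
    intro w j hj
    have h := (hasFDerivAt_pi'.1 hdu.snd j)
    have h' : (fun u => (KKT f g J (xbar, (ybar, u))).2 j) = fun u => u j := by
      funext y; simp [KKT, hj]
    rw [h'] at h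
    have := h.unique (hasFDerivAt_apply j ubar)
    exact congrArg (fun L => L w) this
  apply aux_inv
  rintro ⟨w, μ⟩ h0
  have hsplit : A (w, μ) = A (w, 0) + A (0, μ) := by rw [← map_add]; simp
  rw [hsplit] at h0
  have e1 : LagYY f g ubar xbar ybar w + ∑ j, μ j • gradYg g xbar ybar j = 0 := by
    rw [← y1, ← u1]; exact congrArg Prod.fst h0
  have e2 : ∀ j, (A (w, 0)).2 j + (A (0, μ)).2 j = 0 := fun j =>
    congrFun (congrArg Prod.snd h0) j
  have e3 : ∀ j, j ∉ J → μ j = 0 := fun j hj => by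
    have := e2 j; rwa [y3 w j hj, u3 μ j hj, zero_add] at this
  have e4 : ∀ j, j ∈ J → ⟪gradYg g xbar ybar j, w⟫ = 0 := fun j hj => by
    have := e2 j; rwa [y2 w j hj, u2 μ j hj, add_zero] at this
  have hw : w = 0 := by
    refine hSOC w e4 fun v hv => ?_
    rw [eq_neg_of_add_eq_zero_left e1, inner_neg_left, sum_inner, neg_eq_zero]
    refine Finset.sum_eq_zero fun j _ => ?_
    rw [inner_smul_left]
    by_cases hj : j ∈ J
    · rw [hv j hj, mul_zero]
    · simp [e3 j hj]
  subst hw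
  rw [map_zero, zero_add] at e1
  rw [licq_zero hLICQ μ e3 e1]; rfl

theorem statement10 {m p : ℕ}
    (f : ℝ × EuclideanSpace ℝ (Fin m) → ℝ)
    (g : ℝ × EuclideanSpace ℝ (Fin m) → Fin p → ℝ)
    (hf : ContDiff ℝ 3 f) (hg : ContDiff ℝ 3 g)
    (xbar : ℝ) (ybar : EuclideanSpace ℝ (Fin m))
    (hfeas : ∀ j, g (xbar, ybar) j ≤ 0)
    (ubar : Fin p → ℝ)
    (husupp : ∀ j, g (xbar, ybar) j ≠ 0 → ubar j = 0)
    -- ND1 (LICQ) and the multiplier rule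
    (hLICQ : LinearIndependent ℝ
      (fun j : {j : Fin p // g (xbar, ybar) j = 0} => gradYg g xbar ybar j.1))
    (hstat : gradY f xbar ybar + ∑ j, ubar j • gradYg g xbar ybar j = 0)
    -- ND2 (strict complementarity)
    (hSC : ∀ j, g (xbar, ybar) j = 0 → ubar j ≠ 0)
    -- ND3 (second-order condition)
    (hSOC : ∀ w : EuclideanSpace ℝ (Fin m),
      (∀ j, g (xbar, ybar) j = 0 → ⟪gradYg g xbar ybar j, w⟫ = 0) →
      (∀ v : EuclideanSpace ℝ (Fin m),
        (∀ j, g (xbar, ybar) j = 0 → ⟪gradYg g xbar ybar j, v⟫ = 0) →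
        ⟪LagYY f g ubar xbar ybar w, v⟫ = 0) →
      w = 0) :
    ∃ (U : Set ℝ) (Uy : Set (EuclideanSpace ℝ (Fin m)))
      (ycurve : ℝ → EuclideanSpace ℝ (Fin m)),
      IsOpen U ∧ xbar ∈ U ∧ IsOpen Uy ∧ ybar ∈ Uy ∧
      ContDiffOn ℝ 2 ycurve U ∧ ycurve xbar = ybar ∧
      (∀ x ∈ U, ycurve x ∈ Uy) ∧
      ∀ x ∈ U, ∀ y ∈ Uy, ((x, y) ∈ SigmaGC f g ↔ y = ycurve x) := by
  set J : Set (Fin p) := {j | g (xbar, ybar) j = 0} with hJ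
  have cdF := (KKT_cd f g hf hg J).contDiffAt (x := (xbar, (ybar, ubar)))
  have hinv := KKT_inv f g hf hg xbar ybar ubar J hLICQ hSOC
  have hF0 : KKT f g J (xbar, (ybar, ubar)) = 0 := by
    refine Prod.ext hstat (funext fun j => ?_)
    by_cases hj : j ∈ J
    · simp only [KKT, hj, if_true]; exact hj
    · simp only [KKT, hj, if_false]; exact husupp j hj
  have pn : (2 : WithTop ℕ∞) ≠ 0 := by norm_num
  set ψ := cdF.implicitFunction pn hinv with hψ
  have hψ0 : ψ xbar = (ybar, ubar) := cdF.implicitFunction_apply_self pn hinv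
  have hψiff := cdF.eventually_apply_eq_iff_implicitFunction pn hinv
  have hψcd : ContDiffAt ℝ 2 ψ xbar := cdF.contDiffAt_implicitFunction pn hinv
  rw [hF0, ← hψ] at hψiff
  -- multiplier map
  have cgf : Continuous (fun z : ℝ × EE m => gradY f z.1 z.2) := (aux_cd hf).continuous
  have cgg : ∀ j, Continuous (fun z : ℝ × EE m => gradYg g z.1 z.2 j) := fun j =>
    (aux_cd (contDiff_pi.1 hg j)).continuous
  classical
  let T : ℝ × EE m → (Fin p → ℝ) →L[ℝ] (EE m × (Fin p → ℝ)) := fun z =>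
    ∑ j, (ContinuousLinearMap.proj (R := ℝ) (φ := fun _ : Fin p => ℝ) j).smulRight
      (gradYg g z.1 z.2 j, if j ∈ J then (0 : Fin p → ℝ) else Pi.single j 1)
  have hTc : Continuous T := by
    refine continuous_finsetSum _ fun j _ => ?_
    exact (ContinuousLinearMap.smulRightL ℝ (Fin p → ℝ) (EE m × (Fin p → ℝ))
      (ContinuousLinearMap.proj j)).continuous.comp ((cgg j).prodMk continuous_const)
  have hT1 : ∀ z u, (T z u).1 = ∑ j, u j • gradYg g z.1 z.2 j := fun z u => by
    simp [T, Prod.fst_sum]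
  have hT2 : ∀ z u k, (T z u).2 k = if k ∈ J then 0 else u k := fun z u k => by
    simp only [T, ContinuousLinearMap.sum_apply, ContinuousLinearMap.smulRight_apply,
      Prod.snd_sum, Finset.sum_apply, ContinuousLinearMap.proj_apply, Prod.smul_snd, Pi.smul_apply]
    rw [Finset.sum_eq_single k]
    · split_ifs <;> simp
    · intro b _ hb; split_ifs <;> simp [Ne.symm hb]
    · simp
  have hTinj : Function.Injective (T (xbar, ybar)) := by
    rw [injective_iff_map_eq_zero]
    intro u hu
    refine licq_zero hLICQ u (fun j hj => ?_) ?_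
    · have := hT2 (xbar, ybar) u j
      rw [hu] at this; simpa [show j ∉ J from hj] using this.symm
    · have := hT1 (xbar, ybar) u
      rw [hu] at this; simpa using this.symm
  obtain ⟨c, hc, hTb⟩ := aux_lower T hTc (xbar, ybar) hTinj
  -- small neighbourhoods
  have hune : ∀ᶠ u in 𝓝 ubar, ∀ j ∈ J, u j ≠ 0 := by
    rw [Filter.eventually_all]; intro j
    by_cases hj : j ∈ J
    · filter_upwards [(continuous_apply j).continuousAt.eventually_ne (hSC j hj)] with u hu _
      exact hu
    · exact Filter.Eventually.of_forall fun u h => absurd h hj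
  have hgneg : ∀ᶠ z in 𝓝 (xbar, ybar), ∀ j, j ∉ J → g z j < 0 := by
    rw [Filter.eventually_all]; intro j
    by_cases hj : j ∈ J
    · exact Filter.Eventually.of_forall fun u h => absurd hj h
    · have : ContinuousAt (fun z => g z j) (xbar, ybar) :=
        (contDiff_pi.1 hg j).continuous.continuousAt
      filter_upwards [this.eventually_lt_const (lt_of_le_of_ne (hfeas j) hj)] with u hu _
      exact hu
  rw [nhds_prod_eq, Filter.eventually_prod_iff] at hψiff
  obtain ⟨P1, hP1, P2, hP2, hP⟩ := hψiff
  rw [nhds_prod_eq, Filter.eventually_prod_iff] at hP2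
  obtain ⟨Q1, hQ1, Q2, hQ2, hQ⟩ := hP2
  obtain ⟨δ, hδ, hball⟩ := Metric.eventually_nhds_iff.1 (hQ2.and hune)
  let r : ℝ × EE m → EE m := fun z => gradY f z.1 z.2 + ∑ j, ubar j • gradYg g z.1 z.2 j
  have hr : Continuous r := cgf.add (continuous_finsetSum _ fun j _ => by have := cgg j; fun_prop)
  have hr0 : r (xbar, ybar) = 0 := hstat
  have hrs : ∀ᶠ z in 𝓝 (xbar, ybar), ‖r z‖ < c * δ := by
    refine hr.norm.continuousAt.eventually_lt_const ?_
    beta_reduce; rw [hr0, norm_zero]; positivity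
  have hall := (hTb.and hgneg).and hrs
  rw [nhds_prod_eq, Filter.eventually_prod_iff] at hall
  obtain ⟨R1, hR1, R2, hR2, hR⟩ := hall
  obtain ⟨Uy, hUy, hUyo, hUym⟩ := eventually_nhds_iff.1 (hQ1.and hR2)
  have hψc := hψcd.continuousAt
  have hψ1 : ∀ᶠ x in 𝓝 xbar, (ψ x).1 ∈ Uy := by
    have : ContinuousAt (fun x => (ψ x).1) xbar := hψc.fst
    exact this.eventually (by beta_reduce; rw [hψ0]; exact hUyo.mem_nhds hUym)
  have hψ2 : ∀ᶠ x in 𝓝 xbar, Q2 (ψ x).2 := by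
    have : ContinuousAt (fun x => (ψ x).2) xbar := hψc.snd
    exact this.eventually (by beta_reduce; rw [hψ0]; exact hQ2)
  obtain ⟨U, hU, hUo, hUm⟩ := eventually_nhds_iff.1
    ((((hP1.and hR1).and hψ1).and hψ2).and (hψcd.eventually (by decide)))
  refine ⟨U, Uy, fun x => (ψ x).1, hUo, hUm, hUyo, hUym,
    fun x hx => (hU x hx).2.fst.contDiffWithinAt, by simp [hψ0], fun x hx => (hU x hx).1.1.2, ?_⟩
  intro x hx y hy
  obtain ⟨⟨⟨⟨hxP, hxR⟩, hxy⟩, hxu⟩, -⟩ := hU x hx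
  constructor
  · rintro ⟨hfe, u₀, u, hne, hsupp, hsum⟩
    obtain ⟨⟨hb, hneg⟩, hrr⟩ := hR hxR (hUy y hy).2
    have hsJ : ∀ j, j ∉ J → u j = 0 := fun j hj => hsupp j (hneg j hj).ne
    have hu0 : u₀ ≠ 0 := by
      rintro rfl
      apply hne
      have hTu : T (x, y) u = 0 := by
        refine Prod.ext ?_ (funext fun k => ?_)
        · rw [hT1]; simpa using hsum
        · rw [hT2]; split_ifs with hk
          · rfl
          · exact hsJ k hk
      have := hb u
      rw [hTu, norm_zero] at this
      have h0 : ‖u‖ ≤ 0 := nonpos_of_mul_nonpos_right this hc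
      rw [norm_le_zero_iff.1 h0]; rfl
    set v : Fin p → ℝ := u₀⁻¹ • u with hv
    have hvsum : gradY f x y + ∑ j, v j • gradYg g x y j = 0 := by
      have := congrArg (fun t => u₀⁻¹ • t) hsum
      simpa [smul_add, Finset.smul_sum, smul_smul, hu0, hv] using this
    have hvJ : ∀ j, j ∉ J → v j = 0 := fun j hj => by simp [hv, hsJ j hj]
    have hTv : T (x, y) (v - ubar) = (- r (x, y), 0) := by
      refine Prod.ext ?_ (funext fun k => ?_)
      · rw [hT1]
        simp only [Pi.sub_apply, sub_smul, Finset.sum_sub_distrib, r]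
        rw [eq_neg_of_add_eq_zero_right hvsum]; abel
      · rw [hT2]; split_ifs with hk
        · rfl
        · simp [hvJ k hk, husupp k hk]
    have hclose : dist v ubar < δ := by
      have := hb (v - ubar)
      rw [hTv] at this
      have hn : ‖((- r (x, y), 0) : EE m × (Fin p → ℝ))‖ = ‖r (x, y)‖ := by
        simp [Prod.norm_def]
      rw [hn] at this
      rw [dist_eq_norm]
      exact lt_of_mul_lt_mul_left (this.trans_lt hrr) hc.le
    obtain ⟨hvQ, hvne⟩ := hball hclose
    have hK : KKT f g J (x, (y, v)) = 0 := by
      refine Prod.ext hvsum (funext fun j => ?_)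
      by_cases hj : j ∈ J
      · simp only [KKT, hj, if_true]
        by_contra hgj
        refine hvne j hj ?_
        simp [hv, hsupp j hgj]
      · simp only [KKT, hj, if_false]; exact hvJ j hj
    have := (hP hxP (hQ (hUy y hy).1 hvQ)).1 hK
    exact (congrArg Prod.fst this).symm
  · rintro rfl
    obtain ⟨⟨hb, hneg⟩, hrr⟩ := hR hxR (hUy _ hxy).2
    have hK : KKT f g J (x, ((ψ x).1, (ψ x).2)) = 0 :=
      (hP hxP (hQ (hUy _ hxy).1 hxu)).2 rfl
    have hK2 : ∀ j, (KKT f g J (x, ((ψ x).1, (ψ x).2))).2 j = 0 := fun j => by rw [hK]; rfl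
    have hgJ : ∀ j, j ∈ J → g (x, (ψ x).1) j = 0 := fun j hj => by
      have := hK2 j; simpa only [KKT, hj, if_true] using this
    refine ⟨fun j => ?_, 1, (ψ x).2, ?_, fun j hj => ?_, ?_⟩
    · by_cases hj : j ∈ J
      · exact (hgJ j hj).le
      · exact (hneg j hj).le
    · intro h; exact one_ne_zero (congrArg Prod.fst h)
    · have hj' : j ∉ J := fun h => hj (hgJ j h)
      have := hK2 j; simpa only [KKT, hj', if_false] using this
    · rw [one_smul]; exact congrArg Prod.fst hK
end
end

section
/- Consider the unconstrained bilevel program (UBLPP): min_{x,y} F(x,y) s.t. y ∈ argmin_{y'} f(x,y'), with n = 1, F continuously differentiable and f three times continuously differentiable; assume that for every c ∈ ℝ the set {(x,y) : |x − x̄| ≤ 1, f(x,y) ≤ c} is compact. Let (x̄,ȳ) be a local minimizer of (UBLPP) and suppose either (I) S(x̄) = {ȳ} and ∇²_{yy} f(x̄,ȳ) is nonsingular, or (II) S(x̄) = {ȳ, ȳ₂} with ȳ ≠ ȳ₂, the Hessians ∇²_{yy} f(x̄,ȳ) and ∇²_{yy} f(x̄,ȳ₂) are nonsingular, and α := (d/dx)[f(x,y₂(x))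 − f(x,y₁(x))] at x = x̄ is nonzero, where y₁, y₂ are the C² critical-point curves given by the implicit function theorem (∇_y f(x, y_k(x)) = 0, y₁(x̄) = ȳ, y₂(x̄) = ȳ₂). Then there exist μ ≥ 0 and w ∈ ℝᵐ such that 0 = ∇_x F(x̄,ȳ) + μ(∇_x f(x̄,ȳ) − ∇_x f(x̄,ȳ₂)) + [∇²_{yx} f(x̄,ȳ)]ᵀ w and 0 = ∇_y F(x̄,ȳ) + ∇²_{yy} f(x̄,ȳ) w, where in case (I) one has μ = 0 (so the ȳ₂-term is absent) and in case (II) ȳ₂ is the second global minimizer of f(x̄,·). -/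
open scoped RealInnerProductSpace
open Topology

noncomputable section

/-- The unconstrained lower-level solution set `S(x) = argmin_y f(x,y)`. -/
def Sset0 {m : ℕ} (f : ℝ × EuclideanSpace ℝ (Fin m) → ℝ) (x : ℝ) :
    Set (EuclideanSpace ℝ (Fin m)) :=
  {y | ∀ y', f (x, y) ≤ f (x, y')}

/-- The Hessian `∇²_{yy} f(x,y)` of `f(x,·)` as a continuous linear map. -/
def HessYY {m : ℕ} (f : ℝ × EuclideanSpace ℝ (Fin m) → ℝ)
    (x : ℝ) (y : EuclideanSpace ℝ (Fin m)) :
    EuclideanSpace ℝ (Fin m) →L[ℝ] EuclideanSpace ℝ (Fin m) :=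
  fderiv ℝ (fun y' => gradY f x y') y

/-- The mixed second-derivative block `∇²_{yx} f(x,y)` (a vector, since `n = 1`). -/
def HessYX {m : ℕ} (f : ℝ × EuclideanSpace ℝ (Fin m) → ℝ)
    (x : ℝ) (y : EuclideanSpace ℝ (Fin m)) : EuclideanSpace ℝ (Fin m) :=
  deriv (fun x' => gradY f x' y) x

open Filter Asymptotics

theorem aux_hasFDerivY {m : ℕ} {f : ℝ × EuclideanSpace ℝ (Fin m) → ℝ}
    (hf : Differentiable ℝ f) (x : ℝ) (y : EuclideanSpace ℝ (Fin m)) :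
    HasFDerivAt (fun y' => f (x, y'))
      ((fderiv ℝ f (x, y)).comp (ContinuousLinearMap.inr ℝ ℝ (EuclideanSpace ℝ (Fin m)))) y := by
  exact (hf (x, y)).hasFDerivAt.comp y (hasFDerivAt_prodMk_right x y)

theorem aux_derivX {m : ℕ} {f : ℝ × EuclideanSpace ℝ (Fin m) → ℝ}
    (hf : Differentiable ℝ f) (x : ℝ) (y : EuclideanSpace ℝ (Fin m)) :
    deriv (fun x' => f (x', y)) x = fderiv ℝ f (x, y) (1, 0) := by
  have h := ((hf (x, y)).hasFDerivAt.comp x (hasFDerivAt_prodMk_left x y)).hasDerivAt.deriv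
  simpa [Function.comp_def] using h

theorem aux_gradY_inner {m : ℕ} {f : ℝ × EuclideanSpace ℝ (Fin m) → ℝ}
    (hf : Differentiable ℝ f) (x : ℝ) (y v : EuclideanSpace ℝ (Fin m)) :
    ⟪gradY f x y, v⟫ = fderiv ℝ f (x, y) (0, v) := by
  have h := (aux_hasFDerivY hf x y).fderiv
  have h2 := toDual_gradient (𝕜 := ℝ) (f := fun y' => f (x, y')) (x := y)
  rw [h] at h2
  have h3 := congrArg (fun L => L v) h2
  simpa [gradY] using h3

theorem aux_fderiv_split {m : ℕ} {f : ℝ × EuclideanSpace ℝ (Fin m) → ℝ}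
    (hf : Differentiable ℝ f) (x : ℝ) (y v : EuclideanSpace ℝ (Fin m)) :
    fderiv ℝ f (x, y) (1, v) = deriv (fun x' => f (x', y)) x + ⟪gradY f x y, v⟫ := by
  rw [aux_derivX hf, aux_gradY_inner hf, ← map_add]
  simp

theorem aux_gradY_eq {m : ℕ} {f : ℝ × EuclideanSpace ℝ (Fin m) → ℝ}
    (hf : Differentiable ℝ f) :
    (fun z : ℝ × EuclideanSpace ℝ (Fin m) => gradY f z.1 z.2) =
    fun z => (InnerProductSpace.toDual ℝ (EuclideanSpace ℝ (Fin m))).symm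
      ((fderiv ℝ f z).comp (ContinuousLinearMap.inr ℝ ℝ (EuclideanSpace ℝ (Fin m)))) := by
  funext z
  show (InnerProductSpace.toDual ℝ (EuclideanSpace ℝ (Fin m))).symm _ = _
  rw [(aux_hasFDerivY hf z.1 z.2).fderiv]

theorem aux_gradY_diff {m : ℕ} {f : ℝ × EuclideanSpace ℝ (Fin m) → ℝ}
    (hf : ContDiff ℝ 3 f) :
    Differentiable ℝ (fun z : ℝ × EuclideanSpace ℝ (Fin m) => gradY f z.1 z.2) := by
  rw [aux_gradY_eq (hf.differentiable (by norm_num))]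
  have h1 : Differentiable ℝ (fderiv ℝ f) :=
    (hf.fderiv_right (m := 2) (by norm_num)).differentiable (by norm_num)
  have h2 : Differentiable ℝ fun z => (fderiv ℝ f z).comp
      (ContinuousLinearMap.inr ℝ ℝ (EuclideanSpace ℝ (Fin m))) :=
    h1.clm_comp (differentiable_const _)
  exact (InnerProductSpace.toDual ℝ
    (EuclideanSpace ℝ (Fin m))).symm.toContinuousLinearEquiv.differentiable.comp h2

theorem aux_HessYY {m : ℕ} {f : ℝ × EuclideanSpace ℝ (Fin m) → ℝ}
    (hf : ContDiff ℝ 3 f) (x : ℝ) (y v : EuclideanSpace ℝ (Fin m)) :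
    HessYY f x y v = fderiv ℝ (fun z : ℝ × EuclideanSpace ℝ (Fin m) => gradY f z.1 z.2)
      (x, y) (0, v) := by
  have h := ((aux_gradY_diff hf (x, y)).hasFDerivAt.comp y (hasFDerivAt_prodMk_right x y)).fderiv
  have h3 := congrArg (fun L => L v) h
  simpa [HessYY, Function.comp_def] using h3

theorem aux_HessYX {m : ℕ} {f : ℝ × EuclideanSpace ℝ (Fin m) → ℝ}
    (hf : ContDiff ℝ 3 f) (x : ℝ) (y : EuclideanSpace ℝ (Fin m)) :
    HessYX f x y = fderiv ℝ (fun z : ℝ × EuclideanSpace ℝ (Fin m) => gradY f z.1 z.2)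
      (x, y) (1, 0) := by
  have h := ((aux_gradY_diff hf (x, y)).hasFDerivAt.comp x
    (hasFDerivAt_prodMk_left x y)).hasDerivAt.deriv
  simpa [HessYX, Function.comp_def] using h

theorem aux_symm {m : ℕ} {f : ℝ × EuclideanSpace ℝ (Fin m) → ℝ}
    (hf : ContDiff ℝ 3 f) (x : ℝ) (y v w : EuclideanSpace ℝ (Fin m)) :
    ⟪HessYY f x y v, w⟫ = ⟪v, HessYY f x y w⟫ := by
  have hd : Differentiable ℝ f := hf.differentiable (by norm_num)
  have h1 : Differentiable ℝ (fderiv ℝ f) :=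
    (hf.fderiv_right (m := 2) (by norm_num)).differentiable (by norm_num)
  have key : ∀ a b : EuclideanSpace ℝ (Fin m), ⟪HessYY f x y a, b⟫ =
      fderiv ℝ (fderiv ℝ f) (x, y) (0, a) (0, b) := by
    intro a b
    rw [aux_HessYY hf]
    have hA : HasFDerivAt (fun z : ℝ × EuclideanSpace ℝ (Fin m) => ⟪gradY f z.1 z.2, b⟫)
      _ (x, y) := (aux_gradY_diff hf (x, y)).hasFDerivAt.inner ℝ (hasFDerivAt_const b (x, y))
    have hB : HasFDerivAt (fun z : ℝ × EuclideanSpace ℝ (Fin m) => fderiv ℝ f z (0, b))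
      _ (x, y) := (h1 (x, y)).hasFDerivAt.clm_apply (hasFDerivAt_const (0, b) (x, y))
    have hE : (fun z : ℝ × EuclideanSpace ℝ (Fin m) => ⟪gradY f z.1 z.2, b⟫) =
        fun z => fderiv ℝ f z (0, b) := by
      funext z
      exact aux_gradY_inner hd z.1 z.2 b
    rw [hE] at hA
    have := congrArg (fun L => L ((0 : ℝ), a)) (hA.unique hB)
    simpa using this
  rw [key, real_inner_comm, key]
  exact (hf.contDiffAt.isSymmSndFDerivAt (by simp; norm_num)) _ _

theorem aux_quot {m : ℕ} {G : ℝ × EuclideanSpace ℝ (Fin m) → EuclideanSpace ℝ (Fin m)}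
    {G' : ℝ × EuclideanSpace ℝ (Fin m) →L[ℝ] EuclideanSpace ℝ (Fin m)}
    {xb : ℝ} {yb v : EuclideanSpace ℝ (Fin m)}
    (hG : HasFDerivAt G G' (xb, yb)) (hG0 : G (xb, yb) = 0)
    (A : EuclideanSpace ℝ (Fin m) →L[ℝ] EuclideanSpace ℝ (Fin m))
    (hA : ∀ b, A (G' (0, b)) = b) (hv : G' (1, v) = 0)
    {u : Filter ℝ} {s : ℝ → EuclideanSpace ℝ (Fin m)}
    (hu : Tendsto (fun x => (x, s x)) u (𝓝 (xb, yb)))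
    (hne : ∀ᶠ x in u, x ≠ xb)
    (hs : ∀ᶠ x in u, G (x, s x) = 0) :
    Tendsto (fun x => (x - xb)⁻¹ • (s x - yb)) u (𝓝 v) := by
  have h0 := (hasFDerivAt_iff_isLittleO.1 hG).comp_tendsto hu
  set r : ℝ → EuclideanSpace ℝ (Fin m) := fun x => s x - yb - (x - xb) • v with hr
  have h1 : r =o[u] fun x => (x, s x) - (xb, yb) := by
    have h2 := (A.isBigO_comp (fun x => G (x, s x) - G (xb, yb) - G' ((x, s x) - (xb, yb))) u
      ).trans_isLittleO h0
    refine h2.neg_left.congr' ?_ EventuallyEq.rfl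
    filter_upwards [hs] with x hx
    have e : ((x, s x) : ℝ × EuclideanSpace ℝ (Fin m)) - (xb, yb) =
        (x - xb) • ((1 : ℝ), v) + (0, r x) := by
      ext1 <;> simp [hr]
    rw [hx, hG0, e, map_add, map_smul, hv]
    simp [hA]
  have h3 : (fun x => ((x, s x) : ℝ × EuclideanSpace ℝ (Fin m)) - (xb, yb)) =O[u]
      fun x => x - xb := by
    have h4 : (fun x => ((0 : ℝ), r x)) =o[u]
        fun x => ((x, s x) : ℝ × EuclideanSpace ℝ (Fin m)) - (xb, yb) := by
      refine IsBigO.trans_isLittleO (IsBigO.of_bound 1 ?_) h1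
      exact Eventually.of_forall fun x => by simp [Prod.norm_def]
    refine h4.right_isBigO_sub.trans (IsBigO.of_bound (‖((1 : ℝ), v)‖) ?_)
    refine Eventually.of_forall fun x => ?_
    have e : ((x, s x) : ℝ × EuclideanSpace ℝ (Fin m)) - (xb, yb) - (0, r x) =
        (x - xb) • ((1 : ℝ), v) := by
      ext1 <;> simp [hr]
    rw [e, norm_smul, mul_comm]
  have h5 : r =o[u] fun x => x - xb := h1.trans_isBigO h3
  have h6 : Tendsto (fun x => (x - xb)⁻¹ • r x) u (𝓝 0) := by
    rw [tendsto_zero_iff_norm_tendsto_zero]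
    have := h5.norm_norm.tendsto_div_nhds_zero
    refine this.congr fun x => ?_
    rw [norm_smul, norm_inv, div_eq_inv_mul]
  have h7 := h6.add_const v
  rw [zero_add] at h7
  refine h7.congr' ?_
  filter_upwards [hne] with x hx
  have : x - xb ≠ 0 := sub_ne_zero.2 hx
  simp only [hr, smul_sub _ _ ((x - xb) • v), smul_smul, inv_mul_cancel₀ this, one_smul]
  abel

theorem aux_lim {m : ℕ} {g : ℝ × EuclideanSpace ℝ (Fin m) → ℝ}
    {xb : ℝ} {yb v : EuclideanSpace ℝ (Fin m)} (hg : DifferentiableAt ℝ g (xb, yb))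
    {u : Filter ℝ} {s : ℝ → EuclideanSpace ℝ (Fin m)}
    (hu : Tendsto (fun x => (x, s x)) u (𝓝 (xb, yb)))
    (hne : ∀ᶠ x in u, x ≠ xb)
    (hq : Tendsto (fun x => (x - xb)⁻¹ • (s x - yb)) u (𝓝 v)) :
    Tendsto (fun x => (x - xb)⁻¹ * (g (x, s x) - g (xb, yb))) u
      (𝓝 (fderiv ℝ g (xb, yb) (1, v))) := by
  have h := (hasFDerivWithinAt_univ.2 hg.hasFDerivAt).lim (l := u)
    (c := fun x => (x - xb)⁻¹) (d := fun x => (x, s x) - (xb, yb)) (v := (1, v)) ?_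
    (Eventually.of_forall fun _ => Set.mem_univ _) ?_
  · simpa using h
  · simpa using hu.sub_const (xb, yb)
  · have h1 : Tendsto (fun x => (x - xb)⁻¹ • (x - xb)) u (𝓝 1) := by
      refine tendsto_const_nhds.congr' ?_
      filter_upwards [hne] with x hx
      simp [sub_ne_zero.2 hx]
    exact h1.prodMk_nhds hq

theorem aux_gradY_zero {m : ℕ} {f : ℝ × EuclideanSpace ℝ (Fin m) → ℝ}
    {x : ℝ} {y : EuclideanSpace ℝ (Fin m)} (h : y ∈ Sset0 f x) : gradY f x y = 0 := by
  have h1 : IsLocalMin (fun y' => f (x, y')) y := Eventually.of_forall h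
  have h2 := h1.fderiv_eq_zero
  unfold gradY gradient
  rw [h2, map_zero]

/-- quotient limit at a nondegenerate global minimizer -/
theorem aux_quot' {m : ℕ} {f : ℝ × EuclideanSpace ℝ (Fin m) → ℝ} (hf : ContDiff ℝ 3 f)
    {xb : ℝ} {yb : EuclideanSpace ℝ (Fin m)} (hy : yb ∈ Sset0 f xb)
    (hb : Function.Bijective (HessYY f xb yb)) {v : EuclideanSpace ℝ (Fin m)}
    (hv : HessYY f xb yb v = - HessYX f xb yb)
    {u : Filter ℝ} {s : ℝ → EuclideanSpace ℝ (Fin m)}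
    (hu : Tendsto (fun x => (x, s x)) u (𝓝 (xb, yb)))
    (hne : ∀ᶠ x in u, x ≠ xb)
    (hs : ∀ᶠ x in u, s x ∈ Sset0 f x) :
    Tendsto (fun x => (x - xb)⁻¹ • (s x - yb)) u (𝓝 v) := by
  let e := LinearEquiv.ofBijective (HessYY f xb yb).toLinearMap hb
  refine aux_quot (aux_gradY_diff hf (xb, yb)).hasFDerivAt (aux_gradY_zero hy)
    (LinearMap.toContinuousLinearMap e.symm.toLinearMap) ?_ ?_ hu hne ?_
  · intro b
    rw [← aux_HessYY hf]
    exact e.symm_apply_apply b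
  · have : ((1 : ℝ), v) = (1, 0) + (0, v) := by simp
    rw [this, map_add, ← aux_HessYY hf, ← aux_HessYX hf, hv, add_neg_cancel]
  · filter_upwards [hs] with x hx using aux_gradY_zero hx

theorem aux_select {m : ℕ} {f : ℝ × EuclideanSpace ℝ (Fin m) → ℝ} (hf : Continuous f)
    {xb : ℝ} (yb : EuclideanSpace ℝ (Fin m))
    (hIC : ∀ c : ℝ, IsCompact {z : ℝ × EuclideanSpace ℝ (Fin m) |
      |z.1 - xb| ≤ 1 ∧ f z ≤ c}) (x : ℝ) (hx : |x - xb| ≤ 1) :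
    ∃ y, y ∈ Sset0 f x := by
  have hK : IsCompact ({z : ℝ × EuclideanSpace ℝ (Fin m) | |z.1 - xb| ≤ 1 ∧ f z ≤ f (x, yb)} ∩
      {z | z.1 = x}) := (hIC _).inter_right (isClosed_eq continuous_fst continuous_const)
  obtain ⟨⟨x', y⟩, hz, hmin⟩ := hK.exists_isMinOn ⟨(x, yb), ⟨hx, le_rfl⟩, rfl⟩ hf.continuousOn
  obtain ⟨⟨-, h2⟩, h3⟩ := hz
  simp only [Set.mem_ofPred_eq] at h3
  subst h3
  refine ⟨y, fun y' => ?_⟩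
  by_cases h : f (x', y') ≤ f (x', yb)
  · exact hmin ⟨⟨hx, h⟩, rfl⟩
  · exact h2.trans (not_le.1 h).le

theorem aux_ultra {m : ℕ} {f : ℝ × EuclideanSpace ℝ (Fin m) → ℝ} (hf : Continuous f)
    {xb : ℝ} (yb : EuclideanSpace ℝ (Fin m))
    (hIC : ∀ c : ℝ, IsCompact {z : ℝ × EuclideanSpace ℝ (Fin m) |
      |z.1 - xb| ≤ 1 ∧ f z ≤ c}) {σ : ℝ} (hσ : σ ≠ 0) :
    ∃ (u : Ultrafilter ℝ) (s : ℝ → EuclideanSpace ℝ (Fin m)) (y : EuclideanSpace ℝ (Fin m)),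
      (∀ᶠ x in (u : Filter ℝ), 0 < σ * (x - xb)) ∧ (∀ᶠ x in (u : Filter ℝ), s x ∈ Sset0 f x) ∧
      Tendsto (fun x => (x, s x)) u (𝓝 (xb, y)) ∧ y ∈ Sset0 f xb := by
  have hne : (𝓝[{x | 0 < σ * (x - xb)}] xb).NeBot := by
    rw [← mem_closure_iff_nhdsWithin_neBot]
    refine mem_closure_of_tendsto (f := fun t : ℝ => xb + t * σ) (b := 𝓝[>] 0) ?_ ?_
    · have : Tendsto (fun t : ℝ => xb + t * σ) (𝓝 0) (𝓝 (xb + 0 * σ)) :=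
        Continuous.tendsto (by fun_prop) 0
      rw [zero_mul, add_zero] at this
      exact this.mono_left nhdsWithin_le_nhds
    · filter_upwards [self_mem_nhdsWithin] with t ht
      have ht : 0 < t := ht
      have : 0 < σ * σ := mul_self_pos.2 hσ
      show 0 < σ * (xb + t * σ - xb)
      nlinarith [mul_pos ht this]
  let u := Ultrafilter.of (𝓝[{x | 0 < σ * (x - xb)}] xb)
  have hu : (u : Filter ℝ) ≤ 𝓝[{x | 0 < σ * (x - xb)}] xb := Ultrafilter.of_le _
  have hun : (u : Filter ℝ) ≤ 𝓝 xb := hu.trans nhdsWithin_le_nhds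
  have hpos : ∀ᶠ x in (u : Filter ℝ), 0 < σ * (x - xb) := hu self_mem_nhdsWithin
  choose! s hs using aux_select hf yb hIC
  have hcl : ∀ᶠ x in (u : Filter ℝ), |x - xb| ≤ 1 := hun (by
    filter_upwards [Metric.closedBall_mem_nhds xb one_pos] with x hx
    simpa [Real.dist_eq] using hx)
  have hS : ∀ᶠ x in (u : Filter ℝ), s x ∈ Sset0 f x := hcl.mono hs
  have hfb : ∀ᶠ x in (u : Filter ℝ), f (x, yb) < f (xb, yb) + 1 := by
    have hc : Tendsto (fun x => f (x, yb)) (𝓝 xb) (𝓝 (f (xb, yb))) :=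
      Continuous.tendsto (f := fun x => f (x, yb)) (by fun_prop) xb
    exact hun (hc.eventually_lt_const (lt_add_one _))
  have hmem : ((u.map fun x => (x, s x) : Ultrafilter _) : Filter _) ≤
      𝓟 {z : ℝ × EuclideanSpace ℝ (Fin m) | |z.1 - xb| ≤ 1 ∧ f z ≤ f (xb, yb) + 1} := by
    rw [le_principal_iff]
    show ∀ᶠ x in (u : Filter ℝ), |x - xb| ≤ 1 ∧ f (x, s x) ≤ f (xb, yb) + 1
    filter_upwards [hcl, hS, hfb] with x h1 h2 h3
    exact ⟨h1, (h2 yb).trans h3.le⟩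
  obtain ⟨⟨x', y⟩, -, hlim⟩ := (hIC (f (xb, yb) + 1)).ultrafilter_le_nhds _ hmem
  have hlim : Tendsto (fun x => (x, s x)) (u : Filter ℝ) (𝓝 (x', y)) := hlim
  have hx' : x' = xb := by
    have h1 : Tendsto (fun x : ℝ => x) (u : Filter ℝ) (𝓝 x') :=
      (continuous_fst.tendsto (x', y)).comp hlim
    exact tendsto_nhds_unique h1 hun
  subst hx'
  refine ⟨u, s, y, hpos, hS, hlim, fun y' => ?_⟩
  have h1 : Tendsto (fun x => f (x, s x)) (u : Filter ℝ) (𝓝 (f (x', y))) :=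
    (hf.tendsto (x', y)).comp hlim
  have h2 : Tendsto (fun x => f (x, y')) (u : Filter ℝ) (𝓝 (f (x', y'))) :=
    (Continuous.tendsto (f := fun x => f (x, y')) (by fun_prop) x').mono_left hun
  exact le_of_tendsto_of_tendsto h1 h2 (hS.mono fun x hx => hx y')

theorem aux_sign {u : Filter ℝ} [u.NeBot] {σ xb D : ℝ} {q : ℝ → ℝ}
    (hpos : ∀ᶠ x in u, 0 < σ * (x - xb)) (hq : ∀ᶠ x in u, 0 ≤ q x)
    (h : Tendsto (fun x => (x - xb)⁻¹ * q x) u (𝓝 D)) : 0 ≤ σ * D := by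
  refine ge_of_tendsto (h.const_mul σ) ?_
  filter_upwards [hpos, hq] with x h1 h2
  have h3 : x - xb ≠ 0 := by
    rintro h
    simp [h] at h1
  have h4 : σ * (x - xb)⁻¹ = σ * (x - xb) * ((x - xb)⁻¹) ^ 2 := by field_simp
  rw [← mul_assoc, h4]
  positivity

/-- sign of the derivative of the upper-level objective along minimizers -/
theorem aux_core {m : ℕ} {F f : ℝ × EuclideanSpace ℝ (Fin m) → ℝ}
    (hF : ContDiff ℝ 1 F) (hf : ContDiff ℝ 3 f)
    {xb : ℝ} {yb : EuclideanSpace ℝ (Fin m)}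
    (hIC : ∀ c : ℝ, IsCompact {z : ℝ × EuclideanSpace ℝ (Fin m) |
      |z.1 - xb| ≤ 1 ∧ f z ≤ c})
    (hfeas : yb ∈ Sset0 f xb)
    (hlocal : ∃ U ∈ 𝓝 (xb, yb), ∀ z ∈ U, z.2 ∈ Sset0 f z.1 → F (xb, yb) ≤ F z)
    (hb : Function.Bijective (HessYY f xb yb)) {v : EuclideanSpace ℝ (Fin m)}
    (hv : HessYY f xb yb v = - HessYX f xb yb) {σ : ℝ} (hσ : σ ≠ 0)
    (hoth : ∀ y ∈ Sset0 f xb, y ≠ yb → Function.Bijective (HessYY f xb y) ∧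
      0 < σ * (deriv (fun x => f (x, y)) xb - deriv (fun x => f (x, yb)) xb)) :
    0 ≤ σ * fderiv ℝ F (xb, yb) (1, v) := by
  have hfd : Differentiable ℝ f := hf.differentiable (by norm_num)
  obtain ⟨u, s, y, hpos, hS, hlim, hy⟩ := aux_ultra hf.continuous yb hIC hσ
  have hne : ∀ᶠ x in (u : Filter ℝ), x ≠ xb := by
    filter_upwards [hpos] with x hx h
    simp [h] at hx
  by_cases hyy : y = yb
  · subst hyy
    have hq := aux_quot' hf hfeas hb hv hlim hne hS
    have hL := aux_lim (hF.differentiable (by norm_num) (xb, y)) hlim hne hq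
    refine aux_sign hpos ?_ hL
    obtain ⟨U, hU, hUF⟩ := hlocal
    filter_upwards [hlim hU, hS] with x h1 h2
    exact sub_nonneg.2 (hUF _ h1 h2)
  · exfalso
    obtain ⟨hb2, hα⟩ := hoth y hy hyy
    obtain ⟨v2, hv2⟩ := hb2.2 (- HessYX f xb y)
    have hq := aux_quot' hf hy hb2 hv2 hlim hne hS
    have hL := aux_lim (hfd (xb, y)) hlim hne hq
    have hlim0 : Tendsto (fun x => (x, yb)) (u : Filter ℝ) (𝓝 (xb, yb)) :=
      ((continuous_fst.tendsto (xb, y)).comp hlim).prodMk_nhds tendsto_const_nhds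
    have hq0 : Tendsto (fun x => (x - xb)⁻¹ • (yb - yb)) (u : Filter ℝ) (𝓝 0) := by simp
    have hL0 := aux_lim (hfd (xb, yb)) hlim0 hne hq0
    rw [aux_fderiv_split hfd, aux_gradY_zero hy, inner_zero_left, add_zero] at hL
    rw [aux_fderiv_split hfd, inner_zero_right, add_zero] at hL0
    have hfe : f (xb, y) = f (xb, yb) := le_antisymm (hy yb) (hfeas y)
    have h := hL0.sub hL
    have h' := aux_sign (σ := σ) (q := fun x => f (x, yb) - f (x, s x)) hpos
      (by filter_upwards [hS] with x hx using sub_nonneg.2 (hx yb))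
      (h.congr fun x => by rw [hfe]; ring)
    linarith

theorem aux_env {m : ℕ} {f : ℝ × EuclideanSpace ℝ (Fin m) → ℝ} (hf : ContDiff ℝ 3 f)
    {xb : ℝ} {yb : EuclideanSpace ℝ (Fin m)} (hy : yb ∈ Sset0 f xb)
    {N : Set ℝ} (hN : N ∈ 𝓝 xb) {c : ℝ → EuclideanSpace ℝ (Fin m)}
    (hc : ContDiffOn ℝ 2 c N) (hcy : c xb = yb) :
    HasDerivAt (fun x => f (x, c x)) (deriv (fun x => f (x, yb)) xb) xb := by
  have hfd : Differentiable ℝ f := hf.differentiable (by norm_num)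
  have h1 : HasDerivAt c (deriv c xb) xb :=
    ((hc.contDiffAt hN).differentiableAt (by norm_num)).hasDerivAt
  subst hcy
  have h2 := (hfd (xb, c xb)).hasFDerivAt.comp_hasDerivAt xb ((hasDerivAt_id xb).prodMk h1)
  rw [aux_fderiv_split hfd, aux_gradY_zero hy, inner_zero_left, add_zero] at h2
  exact h2

theorem statement16 {m : ℕ}
    (F f : ℝ × EuclideanSpace ℝ (Fin m) → ℝ)
    (hF : ContDiff ℝ 1 F) (hf : ContDiff ℝ 3 f)
    (xbar : ℝ) (ybar ybar2 : EuclideanSpace ℝ (Fin m))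
    -- inf-compactness at x̄
    (hIC : ∀ c : ℝ, IsCompact {z : ℝ × EuclideanSpace ℝ (Fin m) |
      |z.1 - xbar| ≤ 1 ∧ f z ≤ c})
    -- (x̄,ȳ) is a local minimizer of (UBLPP)
    (hfeas : ybar ∈ Sset0 f xbar)
    (hlocal : ∃ U ∈ 𝓝 (xbar, ybar), ∀ z ∈ U, z.2 ∈ Sset0 f z.1 →
      F (xbar, ybar) ≤ F z)
    (N : Set ℝ) (hN : N ∈ 𝓝 xbar)
    (y1 y2 : ℝ → EuclideanSpace ℝ (Fin m))
    -- either Case (I) or Case (II)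
    (hcase :
      -- Case (I): S(x̄) = {ȳ} and ∇²_{yy} f(x̄,ȳ) nonsingular
      (Sset0 f xbar = {ybar} ∧ Function.Bijective (HessYY f xbar ybar))
      ∨
      -- Case (II): S(x̄) = {ȳ, ȳ₂}, both Hessians nonsingular, and α ≠ 0
      (Sset0 f xbar = {ybar, ybar2} ∧ ybar ≠ ybar2 ∧
        Function.Bijective (HessYY f xbar ybar) ∧
        Function.Bijective (HessYY f xbar ybar2) ∧
        ContDiffOn ℝ 2 y1 N ∧ ContDiffOn ℝ 2 y2 N ∧
        y1 xbar = ybar ∧ y2 xbar = ybar2 ∧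
        (∀ x ∈ N, gradY f x (y1 x) = 0 ∧ gradY f x (y2 x) = 0) ∧
        deriv (fun x => f (x, y2 x) - f (x, y1 x)) xbar ≠ 0)) :
    ∃ (μ : ℝ) (w : EuclideanSpace ℝ (Fin m)),
      0 ≤ μ ∧
      0 = deriv (fun x => F (x, ybar)) xbar
          + μ * (deriv (fun x => f (x, ybar)) xbar - deriv (fun x => f (x, ybar2)) xbar)
          + ⟪HessYX f xbar ybar, w⟫ ∧
      (0 : EuclideanSpace ℝ (Fin m)) = gradY F xbar ybar + HessYY f xbar ybar w ∧
      (Sset0 f xbar = {ybar} → μ = 0) := by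
  have hFd : Differentiable ℝ F := hF.differentiable (by norm_num)
  have hb : Function.Bijective (HessYY f xbar ybar) := by
    rcases hcase with h | h
    exacts [h.2, h.2.2.1]
  obtain ⟨v, hv⟩ := hb.2 (- HessYX f xbar ybar)
  obtain ⟨w, hw⟩ := hb.2 (- gradY F xbar ybar)
  have hD : fderiv ℝ F (xbar, ybar) (1, v) =
      deriv (fun x => F (x, ybar)) xbar + ⟪HessYX f xbar ybar, w⟫ := by
    rw [aux_fderiv_split hFd]
    have h := aux_symm hf xbar ybar v w
    rw [hv, hw, inner_neg_left, inner_neg_right] at h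
    have h2 := real_inner_comm v (gradY F xbar ybar)
    linarith
  have hw' : (0 : EuclideanSpace ℝ (Fin m)) = gradY F xbar ybar + HessYY f xbar ybar w := by
    rw [hw, add_neg_cancel]
  rcases hcase with ⟨hS, -⟩ | ⟨hS, hne, -, hb2, hc1, hc2, hy1, hy2, -, hα⟩
  · have hoth : ∀ σ : ℝ, σ ≠ 0 → 0 ≤ σ * fderiv ℝ F (xbar, ybar) (1, v) := by
      intro σ hσ
      refine aux_core hF hf hIC hfeas hlocal hb hv hσ ?_
      intro y hy hyy
      rw [hS] at hy
      exact absurd hy hyy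
    have h1 := hoth 1 one_ne_zero
    have h2 := hoth (-1) (by norm_num)
    refine ⟨0, w, le_rfl, ?_, hw', fun _ => rfl⟩
    linarith
  · have hf2 : ybar2 ∈ Sset0 f xbar := by
      rw [hS]
      simp
    have hder := ((aux_env hf hf2 hN hc2 hy2).sub (aux_env hf hfeas hN hc1 hy1)).deriv
    have hder : deriv (fun x => f (x, y2 x) - f (x, y1 x)) xbar =
      deriv (fun x => f (x, ybar2)) xbar - deriv (fun x => f (x, ybar)) xbar := hder
    rw [hder] at hα
    have hcore := aux_core hF hf hIC hfeas hlocal hb hv hα (by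
      intro y hy hyy
      rw [hS] at hy
      rcases hy with rfl | hy
      · exact absurd rfl hyy
      · have hy : y = ybar2 := hy
        subst hy
        exact ⟨hb2, mul_self_pos.2 hα⟩)
    set α := deriv (fun x => f (x, ybar2)) xbar - deriv (fun x => f (x, ybar)) xbar with hαd
    refine ⟨fderiv ℝ F (xbar, ybar) (1, v) / α, w, ?_, ?_, hw', ?_⟩
    · have : fderiv ℝ F (xbar, ybar) (1, v) / α =
          α * fderiv ℝ F (xbar, ybar) (1, v) * (α⁻¹) ^ 2 := by field_simp
      rw [this]
      positivity
    · have e : deriv (fun x => f (x, ybar)) xbar - deriv (fun x => f (x, ybar2)) xbar = -α := by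
        rw [hαd]; ring
      rw [e, mul_neg, div_mul_cancel₀ _ hα, hD]
      ring
    · intro h
      exfalso
      rw [h] at hf2
      exact hne hf2.symm
end
end
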